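/- Let q be a prime power and F = 𝔽_q. Let s ≥ 1, n_1, …, n_s ≥ 1, M = n_1 + ⋯ + n_s, k ≥ 1, and let d be an integer with 1 ≤ d ≤ M − k + 1. Set Δ := k · binom(M, d−1). Let G be a k × M matrix over F whose columns are indexed by pairs (i, j) with 1 ≤ i ≤ s, 0 ≤ j ≤ n_i − 1. For a field extension K of F and a tuple c = (c_1, …, c_s) with c_i : {0,…,n_i−1} → K and c_i(0) ≠ 0, let S_K(c) be the M × M block diagonal matrix whose i-th block is the n_i × n_i lower triangular Toeplitz matrix with entries (a,b) ↦ c_i(a−b) for a ≥ b and 0 for a < b, and let C_K(c) ⊆ K^M denote the K-linear span of the rows of (G mapped into K) · S_K(c). Suppose that q > Δ and that there exists a finite field extension K of F and a tuple c* over K such that every nonzero element of C_K(c*) has Hamming weight ≥ d. Then there exists a tuple c over F itself (with all c_i(0) ≠ 0) such that every nonzero element of C_F(c) ⊆ F^M has Hamming weight ≥ d. -/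

import Mathlib

/-- The `M × M` block diagonal matrix whose `i`-th block is the `n_i × n_i` lower
triangular Toeplitz matrix with entries `(a, b) ↦ c_i (a − b)` for `a ≥ b` and `0`
otherwise; rows and columns are indexed by pairs `(i, j)`, `1 ≤ i ≤ s`, `0 ≤ j < n_i`. -/
def toeplitzBlockDiag {K : Type*} [Field K] {s : ℕ} {n : Fin s → ℕ}
    (c : ∀ i, Fin (n i) → K) :
    Matrix ((i : Fin s) × Fin (n i)) ((i : Fin s) × Fin (n i)) K :=
  fun p r =>
    if p.1 = r.1 ∧ (r.2 : ℕ) ≤ (p.2 : ℕ) then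
      c p.1 ⟨(p.2 : ℕ) - (r.2 : ℕ), lt_of_le_of_lt (Nat.sub_le _ _) p.2.isLt⟩
    else 0

/-- The code `C_K(c)`: the `K`-linear span of the rows of `(G mapped into K) · S_K(c)`,
where `S_K(c)` is the block diagonal Toeplitz matrix of the tuple `c`. -/
def codeOf {F K : Type*} [Field F] [Field K] [Algebra F K]
    {k s : ℕ} {n : Fin s → ℕ}
    (G : Matrix (Fin k) ((i : Fin s) × Fin (n i)) F) (c : ∀ i, Fin (n i) → K) :
    Submodule K (((i : Fin s) × Fin (n i)) → K) :=
  Submodule.span K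
    (Set.range fun rIdx : Fin k => fun col =>
      ((G.map (algebraMap F K)) * toeplitzBlockDiag c) rIdx col)

/-- Hamming weight: the number of nonzero coordinates. -/
noncomputable def hammingWt {K : Type*} [Field K] {ι : Type*}
    (v : ι → K) : ℕ :=
  Nat.card {col : ι // v col ≠ 0}

theorem aux_rightInv {K : Type*} [Field K] {ι : Type*} [Fintype ι] [DecidableEq ι] {r : ℕ}
    (A : Matrix (Fin r) ι K) (h : ∀ y, Matrix.vecMul y A = 0 → y = 0) :
    ∃ B : Matrix ι (Fin r) K, A * B = 1 := by
  obtain ⟨g, hg⟩ := LinearMap.exists_leftInverse_of_injective (Matrix.toLinearMapRight' A)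
    (LinearMap.ker_eq_bot'.mpr fun y hy => h y (by simpa using hy))
  refine ⟨LinearMap.toMatrixRight' g, ?_⟩
  apply Matrix.toLinearMapRight'.injective
  rw [Matrix.toLinearMapRight'_mul, Matrix.toLinearMapRight'_one]
  simpa using hg

theorem aux_basis {F : Type*} [Field F] {ι : Type*} [Fintype ι] [DecidableEq ι] {k : ℕ}
    (G : Matrix (Fin k) ι F) :
    ∃ (r : ℕ) (_ : r ≤ k) (G' : Matrix (Fin r) ι F) (Y : Matrix (Fin k) (Fin r) F)
      (Z : Matrix (Fin r) (Fin k) F) (B : Matrix ι (Fin r) F),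
      G = Y * G' ∧ G' = Z * G ∧ G' * B = 1 := by
  let W := Submodule.span F (Set.range G)
  let b := Module.finBasis F W
  let G' : Matrix (Fin (Module.finrank F W)) ι F := fun j => (b j : ι → F)
  have hZ : ∀ j, ∃ z : Fin k → F, ∑ i, z i • G i = G' j := fun j =>
    (Submodule.mem_span_range_iff_exists_fun F).mp (b j).2
  choose Z hZ using hZ
  have hB : ∃ B : Matrix ι (Fin (Module.finrank F W)) F, G' * B = 1 := by
    apply aux_rightInv
    intro y hy
    have hli := b.linearIndependent
    rw [Fintype.linearIndependent_iff] at hli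
    funext j
    refine hli y ?_ j
    apply Subtype.ext
    rw [Matrix.vecMul_eq_sum] at hy
    simpa [G'] using hy
  obtain ⟨B, hB⟩ := hB
  refine ⟨Module.finrank F W, ?_, G',
    Matrix.of fun i j => b.repr ⟨G i, Submodule.subset_span ⟨i, rfl⟩⟩ j, Matrix.of Z, B, ?_, ?_, hB⟩
  · simpa [Set.finrank] using finrank_range_le_card (R := F) G
  · ext i p
    have := b.sum_repr ⟨G i, Submodule.subset_span ⟨i, rfl⟩⟩
    have := congrFun (congrArg Subtype.val this) p
    refine Eq.trans ?_ (Matrix.mul_apply).symm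
    refine this.symm.trans ?_
    simp only [AddSubmonoidClass.coe_finsetSum, Finset.sum_apply, Submodule.coe_smul,
      Pi.smul_apply, smul_eq_mul]
    rfl
  · ext j p
    have := congrFun (hZ j) p
    refine Eq.trans ?_ (Matrix.mul_apply).symm
    refine this.symm.trans ?_
    simp only [Finset.sum_apply, Pi.smul_apply, smul_eq_mul]
    rfl

theorem aux_toeplitz_inj {K : Type*} [Field K] {s : ℕ} {n : Fin s → ℕ} (hn : ∀ i, 1 ≤ n i)
    (c : ∀ i, Fin (n i) → K) (hc : ∀ i, c i ⟨0, hn i⟩ ≠ 0)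
    (v : ((i : Fin s) × Fin (n i)) → K) (hv : Matrix.vecMul v (toeplitzBlockDiag c) = 0) :
    v = 0 := by
  by_contra hne
  obtain ⟨p0, hp0⟩ := Function.ne_iff.mp hne
  obtain ⟨p, hp, hmax⟩ := (Set.toFinite {p | v p ≠ 0}).exists_maximalFor
    (fun p : (i : Fin s) × Fin (n i) => (p.2 : ℕ)) _ ⟨p0, hp0⟩
  have h := congrFun hv p
  rw [Matrix.vecMul, dotProduct, Finset.sum_eq_single p] at h
  · have h2 : v p * c p.1 ⟨0, hn p.1⟩ = 0 := by simpa [toeplitzBlockDiag] using h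
    exact (mul_ne_zero hp (hc _)) h2
  · intro t _ htp
    by_cases hvt : v t = 0
    · simp [hvt]
    · have : ¬ (t.1 = p.1 ∧ (p.2 : ℕ) ≤ (t.2 : ℕ)) := by
        rintro ⟨h1, h2⟩
        have h3 : (t.2 : ℕ) ≤ p.2 := hmax hvt h2
        apply htp
        obtain ⟨i, a⟩ := t
        obtain ⟨j, b⟩ := p
        dsimp at h1 h2 h3
        subst h1
        congr
        exact Fin.ext (le_antisymm h3 h2)
      simp [toeplitzBlockDiag, this]
  · simp

/-- Normalised parameters: constant terms are set to `1`. -/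
def auxNorm {K : Type*} [Field K] {s : ℕ} {n : Fin s → ℕ}
    (x : ((i : Fin s) × Fin (n i)) → K) : ∀ i, Fin (n i) → K :=
  fun i j => if (j : ℕ) = 0 then 1 else x ⟨i, j⟩

/-- The generic normalised Toeplitz matrix. -/
noncomputable def auxPoly (K : Type*) [Field K] {s : ℕ} (n : Fin s → ℕ) :
    Matrix ((i : Fin s) × Fin (n i)) ((i : Fin s) × Fin (n i))
      (MvPolynomial ((i : Fin s) × Fin (n i)) K) :=
  fun p r =>
    if p.1 = r.1 ∧ (r.2 : ℕ) ≤ (p.2 : ℕ) then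
      (if (p.2 : ℕ) - (r.2 : ℕ) = 0 then 1 else MvPolynomial.X
        ⟨p.1, ⟨(p.2 : ℕ) - (r.2 : ℕ), lt_of_le_of_lt (Nat.sub_le _ _) p.2.isLt⟩⟩)
    else 0

theorem aux_eval {K : Type*} [Field K] {s : ℕ} (n : Fin s → ℕ)
    (x : ((i : Fin s) × Fin (n i)) → K) :
    (auxPoly K n).map (MvPolynomial.eval x) = toeplitzBlockDiag (auxNorm x) := by
  ext p r
  simp only [Matrix.map_apply, auxPoly, toeplitzBlockDiag, auxNorm]
  split_ifs <;> simp

theorem aux_deg {K : Type*} [Field K] {s : ℕ} (n : Fin s → ℕ) (p r) :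
    (auxPoly K n p r).totalDegree ≤ 1 := by
  unfold auxPoly
  split_ifs <;> simp

theorem aux_det_deg {K σ : Type*} [Field K] {r : ℕ}
    (A : Matrix (Fin r) (Fin r) (MvPolynomial σ K)) (h : ∀ i j, (A i j).totalDegree ≤ 1) :
    A.det.totalDegree ≤ r := by
  rw [Matrix.det_apply]
  apply MvPolynomial.totalDegree_finsetSum_le
  intro τ _
  refine (MvPolynomial.totalDegree_smul_le _ _).trans ?_
  refine (MvPolynomial.totalDegree_finsetProd _ _).trans ?_
  refine (Finset.sum_le_card_nsmul _ _ 1 fun i _ => h _ _).trans ?_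
  simp

theorem aux_lin_deg {K σ ι κ α : Type*} [Field K] [Fintype ι]
    (A : Matrix κ ι K) (P : Matrix ι α (MvPolynomial σ K))
    (h : ∀ i j, (P i j).totalDegree ≤ 1) (i) (j) :
    ((A.map (MvPolynomial.C (σ := σ)) * P : Matrix κ α (MvPolynomial σ K)) i j).totalDegree ≤ 1 := by
  rw [Matrix.mul_apply]
  apply MvPolynomial.totalDegree_finsetSum_le
  intro t _
  refine (MvPolynomial.totalDegree_mul _ _).trans ?_
  simpa using h t j

theorem aux_lin_deg' {K σ ι κ α : Type*} [Field K] [Fintype ι]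
    (A : Matrix ι κ K) (P : Matrix α ι (MvPolynomial σ K))
    (h : ∀ i j, (P i j).totalDegree ≤ 1) (i) (j) :
    ((P * A.map (MvPolynomial.C (σ := σ)) : Matrix α κ (MvPolynomial σ K)) i j).totalDegree ≤ 1 := by
  rw [Matrix.mul_apply]
  apply MvPolynomial.totalDegree_finsetSum_le
  intro t _
  refine (MvPolynomial.totalDegree_mul _ _).trans ?_
  simpa using h i t

theorem aux_mem_code {F K : Type*} [Field F] [Field K] [Algebra F K]
    {k s : ℕ} {n : Fin s → ℕ}
    (G : Matrix (Fin k) ((i : Fin s) × Fin (n i)) F) (c : ∀ i, Fin (n i) → K)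
    (v : ((i : Fin s) × Fin (n i)) → K) :
    v ∈ codeOf G c ↔ ∃ y : Fin k → K,
      Matrix.vecMul y (G.map (algebraMap F K) * toeplitzBlockDiag c) = v := by
  unfold codeOf
  rw [Submodule.mem_span_range_iff_exists_fun]
  simp only [Matrix.vecMul_eq_sum]

theorem aux_toeplitz_map {F K : Type*} [Field F] [Field K] [Algebra F K]
    {s : ℕ} {n : Fin s → ℕ} (x : ((i : Fin s) × Fin (n i)) → F) :
    (toeplitzBlockDiag (auxNorm x)).map (algebraMap F K) =
      toeplitzBlockDiag (auxNorm fun p => algebraMap F K (x p)) := by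
  ext p r
  simp only [Matrix.map_apply, toeplitzBlockDiag, auxNorm]
  split_ifs <;> simp

theorem aux_scale {K : Type*} [Field K] {s : ℕ} {n : Fin s → ℕ} (hn : ∀ i, 1 ≤ n i)
    (c : ∀ i, Fin (n i) → K) (hc : ∀ i, c i ⟨0, hn i⟩ ≠ 0) :
    toeplitzBlockDiag (auxNorm fun p : (i : Fin s) × Fin (n i) => c p.1 p.2 * (c p.1 ⟨0, hn p.1⟩)⁻¹) =
      toeplitzBlockDiag c * Matrix.diagonal fun p : (i : Fin s) × Fin (n i) => (c p.1 ⟨0, hn p.1⟩)⁻¹ := by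
  ext p r
  rw [Matrix.mul_diagonal]
  simp only [toeplitzBlockDiag, auxNorm]
  split_ifs with h1 h2
  · obtain ⟨i, a⟩ := p
    obtain ⟨j, b⟩ := r
    dsimp only at h1 h2 ⊢
    obtain ⟨rfl, h3⟩ := h1
    simp only [h2]
    rw [mul_inv_cancel₀ (hc _)]
  · obtain ⟨i, a⟩ := p
    obtain ⟨j, b⟩ := r
    dsimp only at h1 h2 ⊢
    obtain ⟨rfl, h3⟩ := h1
    rfl
  · simp

/-- Let `F = 𝔽_q`, `M = Σ n_i`, `1 ≤ d ≤ M − k + 1`, and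
`Δ = k · binom(M, d−1)`. If `q > Δ` and there is a finite field extension `K/F` and a
tuple `c*` over `K` (with invertible constant terms) such that every nonzero element of
`C_K(c*)` has Hamming weight `≥ d`, then there is a tuple `c` over `F` itself (with
nonzero constant terms) such that every nonzero element of `C_F(c)` has Hamming
weight `≥ d`. -/
theorem exists_params_over_base_field
    {F : Type*} [Field F] [Fintype F] (q : ℕ) (hq : Fintype.card F = q)
    {s : ℕ} (hs : 1 ≤ s) (n : Fin s → ℕ) (hn : ∀ i, 1 ≤ n i)
    (k : ℕ) (hk : 1 ≤ k) (d : ℕ) (hd1 : 1 ≤ d) (hd2 : d ≤ (∑ i, n i) - k + 1)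
    (G : Matrix (Fin k) ((i : Fin s) × Fin (n i)) F)
    (hqΔ : q > k * (∑ i, n i).choose (d - 1))
    (K : Type*) [Field K] [Algebra F K] [FiniteDimensional F K]
    (cstar : ∀ i, Fin (n i) → K) (hcstar : ∀ i, cstar i ⟨0, hn i⟩ ≠ 0)
    (hstar : ∀ v ∈ codeOf G cstar, v ≠ 0 → d ≤ hammingWt v) :
    ∃ c : ∀ i, Fin (n i) → F, (∀ i, c i ⟨0, hn i⟩ ≠ 0) ∧
      ∀ v ∈ codeOf (K := F) G c, v ≠ 0 → d ≤ hammingWt v := by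
  classical
  obtain ⟨r, hrk, G', Y, Z, B0, hY, hZ, hB0⟩ := aux_basis G
  have hcard : Fintype.card ((i : Fin s) × Fin (n i)) = ∑ i, n i := by simp
  let φ := algebraMap F K
  let xs : ((i : Fin s) × Fin (n i)) → K := fun p => cstar p.1 p.2 * (cstar p.1 ⟨0, hn p.1⟩)⁻¹
  -- the normalised matrix over `K`
  have key : ∀ T ∈ (Finset.univ : Finset ((i : Fin s) × Fin (n i))).powersetCard (d - 1),
      ∃ B : Matrix {p : ((i : Fin s) × Fin (n i)) // p ∉ T} (Fin r) K,
        (G'.map φ * toeplitzBlockDiag (auxNorm xs)).submatrix id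
          (Subtype.val : {p : ((i : Fin s) × Fin (n i)) // p ∉ T} → ((i : Fin s) × Fin (n i))) * B = 1 := by
    intro T hT
    apply aux_rightInv
    intro y hy
    by_contra hy0
    set w := Matrix.vecMul y (G'.map φ * toeplitzBlockDiag cstar) with hw
    have hwmem : w ∈ codeOf G cstar := by
      rw [aux_mem_code]
      refine ⟨Matrix.vecMul y (Z.map φ), ?_⟩
      rw [hw, Matrix.vecMul_vecMul, ← Matrix.mul_assoc]
      congr 2
      conv_rhs => rw [hZ]
      rw [Matrix.map_mul]
    have hw0 : w ≠ 0 := by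
      intro h0
      rw [hw, ← Matrix.vecMul_vecMul] at h0
      have h1 := aux_toeplitz_inj hn cstar hcstar _ h0
      apply hy0
      have h2 : Matrix.vecMul (Matrix.vecMul y (G'.map φ)) (B0.map φ) = 0 := by
        rw [h1, Matrix.zero_vecMul]
      rw [Matrix.vecMul_vecMul, ← Matrix.map_mul, hB0] at h2
      simpa using h2
    have hwt := hstar w hwmem hw0
    have hsub : ∀ p, w p ≠ 0 → p ∈ T := by
      intro p hp
      by_contra hpT
      apply hp
      have h1 := congrFun hy ⟨p, hpT⟩
      have h2 : Matrix.vecMul y (G'.map φ * toeplitzBlockDiag (auxNorm xs)) p = 0 := h1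
      rw [aux_scale hn cstar hcstar, ← Matrix.mul_assoc, ← Matrix.vecMul_vecMul,
        Matrix.vecMul_diagonal] at h2
      exact (mul_eq_zero.mp h2).resolve_right (inv_ne_zero (hcstar _))
    have hle : hammingWt w ≤ T.card := by
      unfold hammingWt
      rw [Nat.card_eq_fintype_card, Fintype.card_subtype]
      exact Finset.card_le_card fun p hp => hsub p (by simpa using hp)
    have := (Finset.mem_powersetCard.mp hT).2
    omega
  choose! B hB using key
  let Q : Matrix (Fin r) ((i : Fin s) × Fin (n i)) (MvPolynomial ((i : Fin s) × Fin (n i)) K) :=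
    (G'.map φ).map (MvPolynomial.C (σ := ((i : Fin s) × Fin (n i)))) * auxPoly K n
  let N : Finset ((i : Fin s) × Fin (n i)) → Matrix (Fin r) (Fin r) (MvPolynomial ((i : Fin s) × Fin (n i)) K) := fun T =>
    Q.submatrix id (Subtype.val : {p : ((i : Fin s) × Fin (n i)) // p ∉ T} → ((i : Fin s) × Fin (n i))) *
      (B T).map (MvPolynomial.C (σ := ((i : Fin s) × Fin (n i))))
  have hN : ∀ T x, (N T).map (MvPolynomial.eval x) =
      (G'.map φ * toeplitzBlockDiag (auxNorm x)).submatrix id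
          (Subtype.val : {p : ((i : Fin s) × Fin (n i)) // p ∉ T} → ((i : Fin s) × Fin (n i))) * B T := by
    intro T x
    simp only [N, Q]
    rw [Matrix.map_mul, ← Matrix.submatrix_map, Matrix.map_mul, aux_eval]
    congr 1
    · congr 2
      ext; simp
    · ext; simp
  let P : MvPolynomial ((i : Fin s) × Fin (n i)) K := ∏ T ∈ (Finset.univ : Finset ((i : Fin s) × Fin (n i))).powersetCard (d - 1), (N T).det
  have hevP : ∀ x, MvPolynomial.eval x P = ∏ T ∈ (Finset.univ : Finset ((i : Fin s) × Fin (n i))).powersetCard (d - 1),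
      ((G'.map φ * toeplitzBlockDiag (auxNorm x)).submatrix id
          (Subtype.val : {p : ((i : Fin s) × Fin (n i)) // p ∉ T} → ((i : Fin s) × Fin (n i))) * B T).det := by
    intro x
    rw [map_prod]
    refine Finset.prod_congr rfl fun T _ => ?_
    rw [RingHom.map_det, ← hN]
    rfl
  have hP0 : P ≠ 0 := by
    intro h0
    have h1 := hevP xs
    rw [h0, map_zero, Finset.prod_congr rfl fun T hT => by rw [hB T hT, Matrix.det_one]] at h1
    simp at h1
  have hdeg : P.totalDegree ≤ k * (∑ i, n i).choose (d - 1) := by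
    refine (MvPolynomial.totalDegree_finsetProd _ _).trans ?_
    refine (Finset.sum_le_card_nsmul _ _ r fun T _ => ?_).trans ?_
    · apply aux_det_deg
      apply aux_lin_deg'
      intro i j
      exact aux_lin_deg _ _ (aux_deg n) i j
    · rw [Finset.card_powersetCard, Finset.card_univ, hcard, smul_eq_mul, mul_comm]
      exact Nat.mul_le_mul_right _ hrk
  have hex : ∃ x : ((i : Fin s) × Fin (n i)) → K, (∀ p, x p ∈ Finset.univ.image φ) ∧ MvPolynomial.eval x P ≠ 0 := by
    by_contra! hcon
    apply hP0
    refine MvPolynomial.eq_zero_of_eval_zero_at_prod_finset P (fun _ => Finset.univ.image φ) ?_ hcon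
    intro p
    rw [Finset.card_image_of_injective _ (algebraMap F K).injective, Finset.card_univ, hq]
    exact ((MvPolynomial.degreeOf_le_totalDegree _ _).trans hdeg).trans_lt hqΔ
  obtain ⟨x, hx, hxP⟩ := hex
  have hx' : ∀ p, ∃ a, φ a = x p := fun p => by simpa using hx p
  choose f hf using hx'
  refine ⟨auxNorm f, fun i => by simp [auxNorm], ?_⟩
  intro v hv hv0
  by_contra hlt
  apply hv0
  rw [aux_mem_code] at hv
  obtain ⟨y, rfl⟩ := hv
  set v := Matrix.vecMul y (G.map (algebraMap F F) * toeplitzBlockDiag (auxNorm f)) with hvdef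
  have hvG' : v = Matrix.vecMul (Matrix.vecMul y Y) (G' * toeplitzBlockDiag (auxNorm f)) := by
    rw [hvdef, Matrix.vecMul_vecMul, ← Matrix.mul_assoc, ← hY]
    rfl
  have hsc : (Finset.univ.filter fun p => v p ≠ 0).card ≤ d - 1 := by
    have : hammingWt v = (Finset.univ.filter fun p => v p ≠ 0).card := by
      unfold hammingWt
      rw [Nat.card_eq_fintype_card, Fintype.card_subtype]
    omega
  obtain ⟨T, hT1, -, hT2⟩ := Finset.exists_subsuperset_card_eq
    (Finset.subset_univ (Finset.univ.filter fun p => v p ≠ 0)) hsc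
    (by rw [Finset.card_univ, hcard]; omega)
  rw [hevP, Finset.prod_ne_zero_iff] at hxP
  have hdet := hxP T (Finset.mem_powersetCard.mpr ⟨Finset.subset_univ _, hT2⟩)
  have hxf : x = fun p => algebraMap F K (f p) := funext fun p => (hf p).symm
  have hz : Matrix.vecMul (fun j => φ (Matrix.vecMul y Y j))
      ((G'.map φ * toeplitzBlockDiag (auxNorm x)).submatrix id
        (Subtype.val : {p : ((i : Fin s) × Fin (n i)) // p ∉ T} → ((i : Fin s) × Fin (n i)))) = 0 := by
    funext p
    have h1 : v p.1 = 0 := by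
      by_contra h
      exact p.2 (hT1 (by simpa using h))
    rw [hxf, ← aux_toeplitz_map, ← Matrix.map_mul]
    have h2 := RingHom.map_vecMul φ (G' * toeplitzBlockDiag (auxNorm f)) (Matrix.vecMul y Y) p.1
    rw [← hvG', h1, map_zero] at h2
    exact h2.symm
  have hz2 := Matrix.eq_zero_of_vecMul_eq_zero hdet
    (v := fun j => φ (Matrix.vecMul y Y j)) (by rw [← Matrix.vecMul_vecMul, hz, Matrix.zero_vecMul])
  have hz3 : Matrix.vecMul y Y = 0 := by
    funext j
    exact (map_eq_zero φ).mp (congrFun hz2 j)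
  rw [hvG', hz3, Matrix.zero_vecMul]
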